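/- arXiv:1205.0860 — 10 statements merged into one kernel-verified Lean document; each statement's English description precedes it below -/
import Mathlib

section
/- Let R be a commutative Noetherian ring such that every finitely generated R-module has finite projective dimension and every finitely generated projective R-module is stably free. Then for every submonoid S ⊆ R, every finitely generated projective module over the localisation S⁻¹R is stably free. (This is the statement 'K₀(S⁻¹R) = ℤ' given 'R regular and K₀(R) = ℤ'.) -/
/-- A finitely generated projective module is *stably free* if adding a finite free module
makes it free of finite rank. -/
def IsStablyFree (R : Type u) [CommRing R] (P : Type u) [AddCommGroup P] [Module R P] : Prop :=
  ∃ (a n : ℕ), Nonempty ((P × (Fin a → R)) ≃ₗ[R] (Fin n → R))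

/-- `ProjDimLE R n M` means `M` admits a projective resolution of length `≤ n` by finitely
generated projective modules, i.e. `M` has projective dimension at most `n`. -/
def ProjDimLE (R : Type u) [CommRing R] :
    ℕ → ∀ (M : Type u) [AddCommGroup M] [Module R M], Prop
  | 0, M, _, _ => Module.Projective R M
  | (n + 1), M, _, _ =>
      ∃ (P : Type u) (_ : AddCommGroup P) (_ : Module R P) (f : P →ₗ[R] M),
        Module.Finite R P ∧ Module.Projective R P ∧ Function.Surjective f ∧
          ProjDimLE R n (LinearMap.ker f)

/-- A localisation of a stably free module is stably free. -/
theorem IsStablyFree.of_isLocalizedModule {R : Type u} [CommRing R] {S : Submonoid R}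
    {A : Type u} [CommRing A] [Algebra R A] [IsLocalization S A]
    {M N : Type u} [AddCommGroup M] [Module R M] [AddCommGroup N] [Module R N] [Module A N]
    [IsScalarTower R A N] (g : M →ₗ[R] N) [IsLocalizedModule S g] (h : IsStablyFree R M) :
    IsStablyFree A N := by
  obtain ⟨a, n, ⟨e⟩⟩ := h
  exact ⟨a, n, ⟨IsLocalizedModule.mapEquiv S
    (g.prodMap (.pi fun i : Fin a ↦ Algebra.linearMap R A ∘ₗ .proj i))
    (.pi fun i : Fin n ↦ Algebra.linearMap R A ∘ₗ .proj i) A e⟩⟩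

theorem IsStablyFree.of_linearEquiv {A : Type u} [CommRing A] {M N : Type u}
    [AddCommGroup M] [Module A M] [AddCommGroup N] [Module A N] (e : M ≃ₗ[A] N)
    (h : IsStablyFree A M) : IsStablyFree A N := by
  obtain ⟨a, n, ⟨φ⟩⟩ := h
  exact ⟨a, n, ⟨(e.symm.prodCongr (.refl A _)).trans φ⟩⟩

/-- If `K` and `K × N` are stably free, then so is `N`. -/
theorem IsStablyFree.of_prod_left {A : Type u} [CommRing A] {K N : Type u}
    [AddCommGroup K] [Module A K] [AddCommGroup N] [Module A N]
    (hK : IsStablyFree A K) (hKN : IsStablyFree A (K × N)) : IsStablyFree A N := by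
  obtain ⟨a, b, ⟨φ⟩⟩ := hK
  obtain ⟨c, d, ⟨ψ⟩⟩ := hKN
  let free (m n : ℕ) : ((Fin m → A) × (Fin n → A)) ≃ₗ[A] (Fin (m + n) → A) :=
    (LinearEquiv.sumArrowLequivProdArrow (Fin m) (Fin n) A A).symm.trans
      (LinearEquiv.funCongrLeft A A finSumFinEquiv.symm)
  let shuffle : (N × ((K × (Fin a → A)) × (Fin c → A))) ≃ₗ[A]
      (((K × N) × (Fin c → A)) × (Fin a → A)) :=
    { toFun := fun x ↦ (((x.2.1.1, x.1), x.2.2), x.2.1.2)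
      invFun := fun x ↦ (x.1.1.2, ((x.1.1.1, x.2), x.1.2))
      map_add' := fun _ _ ↦ rfl
      map_smul' := fun _ _ ↦ rfl
      left_inv := fun _ ↦ rfl
      right_inv := fun _ ↦ rfl }
  exact ⟨b + c, d + a, ⟨((LinearEquiv.refl A N).prodCongr
    ((free b c).symm.trans (φ.symm.prodCongr (.refl A _)))).trans
      (shuffle.trans ((ψ.prodCongr (.refl A _)).trans (free d a)))⟩⟩

/-- The domain of a surjection onto a projective module is the product of the kernel and the
codomain. -/
theorem LinearMap.nonempty_equiv_ker_prod {A : Type*} [Ring A] {M N : Type*}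
    [AddCommGroup M] [Module A M] [AddCommGroup N] [Module A N] [Module.Projective A N]
    (f : M →ₗ[A] N) (hf : Function.Surjective f) : Nonempty (M ≃ₗ[A] LinearMap.ker f × N) := by
  obtain ⟨l, hl⟩ := Module.projective_lifting_property f .id hf
  exact ⟨((f.exact_subtype_ker_map).splitSurjectiveEquiv (LinearMap.ker f).injective_subtype
    ⟨l, hl⟩).1⟩

/-- Let `R` be a Noetherian ring over which finitely generated projective modules are stably free.
If a localisation of a finitely generated module of finite projective dimension is projective,
then it is stably free. -/
theorem ProjDimLE.isStablyFree_of_isLocalizedModule {R : Type u} [CommRing R] [IsNoetherianRing R]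
    (hsf : ∀ (P : Type u) [AddCommGroup P] [Module R P], Module.Finite R P →
      Module.Projective R P → IsStablyFree R P)
    (S : Submonoid R) {A : Type u} [CommRing A] [Algebra R A] [IsLocalization S A] (n : ℕ)
    {M N : Type u} [AddCommGroup M] [Module R M] [Module.Finite R M] [AddCommGroup N]
    [Module R N] [Module A N] [IsScalarTower R A N] [Module.Projective A N]
    (g : M →ₗ[R] N) [IsLocalizedModule S g] (h : ProjDimLE R n M) : IsStablyFree A N := by
  induction n generalizing M N with
  | zero => exact (hsf M ‹_› h).of_isLocalizedModule (S := S) g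
  | succ n ih =>
    obtain ⟨P, _, _, f, _, hP, hf, hker⟩ := h
    let ι : P →ₗ[R] LocalizedModule S P := LocalizedModule.mkLinearMap S P
    let : Module A (LocalizedModule S P) := LocalizedModule.moduleOfIsLocalization
    let F : LocalizedModule S P →ₗ[A] N := IsLocalizedModule.mapExtendScalars S ι g A f
    have hF : Function.Surjective F := IsLocalizedModule.map_surjective S ι g f hf
    obtain ⟨e⟩ := F.nonempty_equiv_ker_prod hF
    have : Module.Projective A (LocalizedModule S P) :=
      Module.projective_of_isLocalizedModule S ι
    have : Module.Projective A (LinearMap.ker F) :=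
      .of_split (e.symm.toLinearMap ∘ₗ .inl A _ N) (.fst A _ N ∘ₗ e.toLinearMap) (by ext; simp)
    let κ : LinearMap.ker f →ₗ[R] LinearMap.ker F := LinearMap.toKerIsLocalized S ι g f
    have : IsLocalizedModule S κ := LinearMap.toKerLocalized_isLocalizedModule A S ι g f
    exact (ih κ hker).of_prod_left
      (((hsf P ‹_› hP).of_isLocalizedModule (S := S) ι).of_linearEquiv e)

/-- Every finitely generated module over a localisation `A` of `R` is a localisation of a finitely
generated `R`-module. -/
theorem IsLocalization.exists_finite_isLocalizedModule {R : Type u} [CommRing R] (S : Submonoid R)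
    (A : Type u) [CommRing A] [Algebra R A] [IsLocalization S A] (N : Type u) [AddCommGroup N]
    [Module R N] [Module A N] [IsScalarTower R A N] [Module.Finite A N] :
    ∃ (M : Submodule R N), Module.Finite R M ∧ IsLocalizedModule S M.subtype := by
  obtain ⟨s, hs⟩ := Module.Finite.fg_top (R := A) (M := N)
  have := isLocalizedModule_id S N A
  let M := Submodule.span R (s : Set N)
  have hM : M.localized' A S LinearMap.id = ⊤ := by simp [M, hs]
  refine ⟨M, Module.Finite.span_finset R s, ?_⟩
  let e := (LinearEquiv.ofTop _ hM).restrictScalars R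
  exact IsLocalizedModule.of_linearEquiv S (M.toLocalized' A S LinearMap.id) e

/-- If `R` is a commutative Noetherian ring such that every finitely generated
`R`-module has finite projective dimension ("`R` regular") and every finitely generated
projective `R`-module is stably free ("`K₀(R) = ℤ`"), then for any submonoid `S ⊆ R` every
finitely generated projective module over `S⁻¹R` is stably free ("`K₀(S⁻¹R) = ℤ`"). -/
theorem K0_of_localisation (R : Type u) [CommRing R] [IsNoetherianRing R]
    (hreg : ∀ (M : Type u) [AddCommGroup M] [Module R M], Module.Finite R M →
      ∃ n, ProjDimLE R n M)
    (hsf : ∀ (P : Type u) [AddCommGroup P] [Module R P], Module.Finite R P →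
      Module.Projective R P → IsStablyFree R P)
    (S : Submonoid R)
    (Q : Type u) [AddCommGroup Q] [Module (Localization S) Q]
    (hQfin : Module.Finite (Localization S) Q)
    (hQproj : Module.Projective (Localization S) Q) :
    IsStablyFree (Localization S) Q := by
  let : Module R Q := Module.compHom Q (algebraMap R (Localization S))
  have : IsScalarTower R (Localization S) Q := .of_algebraMap_smul fun _ _ ↦ rfl
  obtain ⟨M, hM, _⟩ := IsLocalization.exists_finite_isLocalizedModule S (Localization S) Q
  obtain ⟨n, hn⟩ := hreg M hM
  exact hn.isStablyFree_of_isLocalizedModule hsf S n M.subtype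
end

section
/- Let R be a Noetherian integrally closed (normal) domain with fraction field K, and let t ∈ R be a prime element. Then, inside K, the intersection of the localisation R_t (R with the powers of t inverted) with the localisation R_{tR} (R localised at the prime ideal tR) is exactly R: if x ∈ K lies in the image of both R_t and R_{tR} in K, then x lies in the image of R. -/
/-- Let `R` be a Noetherian integrally closed (normal) domain with fraction
field `K` and let `t ∈ R` be a prime element.  If `x ∈ K` lies both in the image of the
localisation `R_t` (i.e. `x = r / tⁿ` for some `r ∈ R`, `n ∈ ℕ`) and in the image of the
localisation `R_{tR}` at the prime ideal `tR` (i.e. `x = r / s` with `s ∉ tR`), then `x`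
lies in the image of `R`.  In other words `R_t ∩ R_{tR} = R` inside `K`. -/
theorem localisation_away_inter_atPrime (R : Type*) [CommRing R] [IsDomain R]
    [IsNoetherianRing R] [IsIntegrallyClosed R]
    (t : R) (ht : Prime t) (x : FractionRing R)
    (h1 : ∃ (r : R) (n : ℕ),
      x * (algebraMap R (FractionRing R) t) ^ n = algebraMap R (FractionRing R) r)
    (h2 : ∃ (r s : R), s ∉ Ideal.span {t} ∧
      x * algebraMap R (FractionRing R) s = algebraMap R (FractionRing R) r) :
    ∃ r : R, x = algebraMap R (FractionRing R) r := by
  obtain ⟨a, n, ha⟩ := h1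
  obtain ⟨b, s, hs, hb⟩ := h2
  rw [Ideal.mem_span_singleton] at hs
  have hinj := IsFractionRing.injective R (FractionRing R)
  have has : a * s = t ^ n * b := hinj <| by
    rw [map_mul, map_mul, map_pow, ← ha, ← hb]
    ring
  obtain ⟨c, rfl⟩ := ht.pow_dvd_of_dvd_mul_right n hs ⟨b, has⟩
  have htn : algebraMap R (FractionRing R) t ^ n ≠ 0 :=
    pow_ne_zero n ((map_ne_zero_iff _ hinj).mpr ht.ne_zero)
  refine ⟨c, mul_right_cancel₀ htn ?_⟩
  rw [ha, map_mul, map_pow, mul_comm]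
end

section
/- Let R be a commutative ring that is weakly k-fold stable, and let S ⊆ R be a submonoid. Then the localisation S⁻¹R is weakly k-fold stable. -/
/-- A commutative ring `R` is *weakly `k`-fold stable* if for all `b₁, …, b_{k-1} ∈ R`
there is a unit `u ∈ Rˣ` such that all `1 + u·bᵢ` are units. -/
def WeaklyStable (R : Type*) [CommRing R] (k : ℕ) : Prop :=
  ∀ b : Fin (k - 1) → R, ∃ u : Rˣ, ∀ i, IsUnit (1 + (u : R) * b i)

/-- Weak `k`-fold stability passes to localisations: if `R` is weakly `k`-fold
stable and `S ⊆ R` is a submonoid then `S⁻¹R` is weakly `k`-fold stable. -/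
theorem weaklyStable_localization (R : Type*) [CommRing R] (k : ℕ)
    (h : WeaklyStable R k) (S : Submonoid R) :
    WeaklyStable (Localization S) k := by
  intro b
  obtain ⟨s, hs⟩ := IsLocalization.exist_integer_multiples_of_finite S b
  choose a ha using hs
  obtain ⟨v, hv⟩ := h a
  refine ⟨Units.map (algebraMap R (Localization S)).toMonoidHom v *
    (IsLocalization.map_units (Localization S) s).unit, fun i => ?_⟩
  have hi := (hv i).map (algebraMap R (Localization S))
  rw [map_add, map_one, map_mul, ha i, Algebra.smul_def, ← mul_assoc] at hi
  exact hi
end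

section
/- Let A be a commutative local ring whose residue field has more than k elements (i.e. the residue field is infinite or has cardinality > k). Then A is k-fold stable. -/
/-- A commutative ring `R` is *`k`-fold stable* if whenever `(a₁,b₁), …, (a_k,b_k)` are
pairs of elements with each `⟨aᵢ, bᵢ⟩ = R`, there is an `r ∈ R` with all `aᵢ + r·bᵢ`
units. -/
def KFoldStable (R : Type*) [CommRing R] (k : ℕ) : Prop :=
  ∀ a b : Fin k → R, (∀ i, Ideal.span {a i, b i} = ⊤) →
    ∃ r : R, ∀ i, IsUnit (a i + r * b i)

/-- A commutative local ring whose residue field has more than `k` elements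
(that is, is infinite or of cardinality `> k`) is `k`-fold stable. -/
theorem kFoldStable_of_local (A : Type*) [CommRing A] [IsLocalRing A] (k : ℕ)
    (hcard : Infinite (IsLocalRing.ResidueField A) ∨
      k < Nat.card (IsLocalRing.ResidueField A)) :
    KFoldStable A k := by
  classical
  intro a b hab
  let res := IsLocalRing.residue A
  let s : Finset (IsLocalRing.ResidueField A) :=
    Finset.univ.image fun i => -res (a i) / res (b i)
  have hs : s.card ≤ k := Finset.card_image_le.trans_eq (Finset.card_fin k)
  obtain ⟨x, hx⟩ : ∃ x, x ∉ s := by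
    rcases hcard with h | h
    · exact Infinite.exists_notMem_finset s
    · by_contra! hall
      have huniv : (s : Set (IsLocalRing.ResidueField A)) = Set.univ :=
        Set.eq_univ_of_forall hall
      rw [← Set.ncard_univ, ← huniv, Set.ncard_coe_finset] at h
      exact absurd hs h.not_ge
  obtain ⟨r, rfl⟩ := IsLocalRing.residue_surjective x
  refine ⟨r, fun i => ?_⟩
  rw [← IsLocalRing.residue_ne_zero_iff_isUnit, map_add, map_mul]
  intro h
  by_cases hb : res (b i) = 0
  · have ha : res (a i) = 0 := by simpa [res, hb] using h
    obtain ⟨u, v, huv⟩ :=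
      Ideal.mem_span_pair.mp ((Ideal.eq_top_iff_one _).mp (hab i))
    have hres := congrArg res huv
    rw [map_add, map_mul, map_mul, ha, hb, map_one] at hres
    simp at hres
  · refine hx (Finset.mem_image.mpr ⟨i, Finset.mem_univ i, ?_⟩)
    rw [div_eq_iff hb]
    exact neg_eq_of_add_eq_zero_right h
end

section
/- Let R be a commutative ring that is weakly 5-fold stable, let G be an (additively written) abelian group, and let s : Rˣ × Rˣ → G be a bimultiplicative map satisfying the Steinberg relation. Then s(a, −a) = 0 for every unit a of R. (That is, relation (S2) follows from (S1) and (S3).) -/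
/-- A bimultiplicative Steinberg map satisfies `s(b, -b) = 0` whenever `1 - b` is a unit. -/
theorem steinberg_neg_self_of_isUnit_one_sub {R G : Type*} [CommRing R] [AddCommGroup G]
    (s : Rˣ → Rˣ → G)
    (hmul_left : ∀ a b c : Rˣ, s (a * b) c = s a c + s b c)
    (hmul_right : ∀ a b c : Rˣ, s a (b * c) = s a b + s a c)
    (hsteinberg : ∀ a b : Rˣ, (a : R) + (b : R) = 1 → s a b = 0)
    (b : Rˣ) (hb : IsUnit (1 - (b : R))) :
    s b (-b) = 0 := by
  obtain ⟨c, hc⟩ := hb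
  have hbc : s b c = 0 := hsteinberg b c (by rw [hc]; ring)
  have hbd_inv : s b⁻¹ (-(b⁻¹ * c)) = 0 := by
    refine hsteinberg _ _ ?_
    push_cast
    rw [hc, mul_sub, Units.inv_mul]
    ring
  have hone : s 1 (-(b⁻¹ * c)) = 0 := by
    simpa using hmul_left 1 1 (-(b⁻¹ * c))
  have hbd : s b (-(b⁻¹ * c)) = 0 := by
    have h := hmul_left b b⁻¹ (-(b⁻¹ * c))
    rw [mul_inv_cancel, hone, hbd_inv, add_zero] at h
    exact h.symm
  have h := hmul_right b (-b) (-(b⁻¹ * c))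
  rw [neg_mul_neg, mul_inv_cancel_left, hbc, hbd, add_zero] at h
  exact h.symm

/-- Let `R` be weakly `5`-fold stable, `G` an abelian group and
`s : Rˣ × Rˣ → G` a bimultiplicative map satisfying the Steinberg relation (S3).  Then `s`
is skew-symmetric: `s(a, -a) = 0` for every unit `a`; i.e. (S2) follows from (S1) and
(S3). -/
theorem steinberg_skew_symmetry (R : Type*) [CommRing R] (h5 : WeaklyStable R 5)
    (G : Type*) [AddCommGroup G] (s : Rˣ → Rˣ → G)
    (hmul_left : ∀ a b c : Rˣ, s (a * b) c = s a c + s b c)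
    (hmul_right : ∀ a b c : Rˣ, s a (b * c) = s a b + s a c)
    (hsteinberg : ∀ a b : Rˣ, (a : R) + (b : R) = 1 → s a b = 0)
    (a : Rˣ) :
    s a (-a) = 0 := by
  have hneg := steinberg_neg_self_of_isUnit_one_sub s hmul_left hmul_right hsteinberg
  have expand : ∀ u : Rˣ, IsUnit (1 - (u : R)) → IsUnit (1 - (a : R) * u) →
      s a (-a) + s a u + s u a = 0 := by
    intro u hu hau
    have h := hneg (a * u) (by simpa using hau)
    rw [hmul_left, ← neg_mul, hmul_right a, neg_mul, ← mul_neg, hmul_right u, hneg u hu,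
      add_zero] at h
    exact h
  obtain ⟨u, hu⟩ := h5 ![-1, -(a : R), 0, 0]
  have hu₁ : IsUnit (1 - (u : R)) := by
    convert hu 0 using 1
    simp [sub_eq_add_neg]
  have hau : IsUnit (1 - (a : R) * u) := by
    convert hu 1 using 1
    simp [sub_eq_add_neg, mul_comm]
  obtain ⟨v, hv⟩ := h5 ![-1, -(a : R), -(u : R), -((a : R) * u)]
  have hv₁ : IsUnit (1 - (v : R)) := by
    convert hv 0 using 1
    simp [sub_eq_add_neg]
  have hav : IsUnit (1 - (a : R) * v) := by
    convert hv 1 using 1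
    simp [sub_eq_add_neg, mul_comm]
  have huv : IsUnit (1 - ((u * v : Rˣ) : R)) := by
    convert hv 2 using 1
    simp [sub_eq_add_neg, mul_comm]
  have hauv : IsUnit (1 - (a : R) * ((u * v : Rˣ) : R)) := by
    convert hv 3 using 1
    simp [sub_eq_add_neg, mul_comm, mul_left_comm]
  have eu := expand u hu₁ hau
  have ev := expand v hv₁ hav
  have euv := expand (u * v) huv hauv
  rw [hmul_right, hmul_left] at euv
  calc s a (-a) = (s a (-a) + s a u + s u a) + (s a (-a) + s a v + s v a)
        - (s a (-a) + (s a u + s a v) + (s u a + s v a)) := by abel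
    _ = 0 := by rw [eu, ev, euv]; simp
end

section
/- Let R be a 3-fold stable commutative ring and let t, a ∈ R be such that 1 + a·t is a unit of R. Then there exist units v, w of R such that 1 + v·t and 1 + w·t are units and (1 + v·t)·(1 + w·t) = 1 + a·t. In particular, the group of units of R lying in 1 + tR is generated by its elements of the form 1 + t·w with w a unit of R. -/
/-- In a `3`-fold stable ring, every unit `1 + a * t` is a product of two units of the form
`1 + v * t` with `v` a unit. -/
theorem KFoldStable.exists_mul_eq_one_add_mul {R : Type*} [CommRing R] (h3 : KFoldStable R 3)
    (t a : R) (ha : IsUnit (1 + a * t)) :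
    ∃ v w : Rˣ, IsUnit (1 + (v : R) * t) ∧ IsUnit (1 + (w : R) * t) ∧
      (1 + (v : R) * t) * (1 + (w : R) * t) = 1 + a * t := by
  obtain ⟨r, hr⟩ := h3 ![0, a, 1] ![1, -1, t] (by
    intro i
    rw [Ideal.eq_top_iff_one, Ideal.mem_span_pair]
    fin_cases i
    · exact ⟨0, 1, by simp⟩
    · exact ⟨0, -1, by simp⟩
    · exact ⟨1, 0, by simp⟩)
  have hv : IsUnit r := by simpa using hr 0
  have hw : IsUnit (a - r) := by simpa [sub_eq_add_neg] using hr 1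
  obtain ⟨u, hu⟩ : IsUnit (1 + r * t) := by simpa using hr 2
  obtain ⟨v, rfl⟩ := hv
  obtain ⟨w, hw⟩ := hw
  have hmul : (1 + (v : R) * t) * (1 + ((w * u⁻¹ : Rˣ) : R) * t) = 1 + a * t := by
    rw [← hu, Units.val_mul, hw]
    linear_combination (a - v) * t * u.mul_inv + hu
  exact ⟨v, w * u⁻¹, ⟨u, hu⟩, isUnit_of_mul_isUnit_right (hmul ▸ ha), hmul⟩

/-- Let `R` be `3`-fold stable and `t, a ∈ R` with `1 + a·t` a unit.  Then
there are units `v, w ∈ Rˣ` with `1 + v·t` and `1 + w·t` units and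
`(1 + v·t)·(1 + w·t) = 1 + a·t`.  In particular, the group `(1 + tR)ˣ` is generated by
its elements of the form `1 + t·w` with `w ∈ Rˣ` (assumption (A3)). -/
theorem three_fold_stable_A3 (R : Type*) [CommRing R] (h3 : KFoldStable R 3)
    (t a : R) (ha : IsUnit (1 + a * t)) :
    (∃ v w : Rˣ, IsUnit (1 + (v : R) * t) ∧ IsUnit (1 + (w : R) * t) ∧
      (1 + (v : R) * t) * (1 + (w : R) * t) = 1 + a * t) ∧
    (∀ x : Rˣ, (x : R) - 1 ∈ Ideal.span {t} →
      x ∈ Subgroup.closure {y : Rˣ | ∃ w : Rˣ, (y : R) = 1 + t * (w : R)}) := by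
  refine ⟨h3.exists_mul_eq_one_add_mul t a ha, fun x hx => ?_⟩
  obtain ⟨b, hb⟩ := Ideal.mem_span_singleton'.1 hx
  have hxb : (x : R) = 1 + b * t := by rw [hb]; ring
  obtain ⟨v, w, ⟨y, hy⟩, ⟨z, hz⟩, hyz⟩ := h3.exists_mul_eq_one_add_mul t b (hxb ▸ x.isUnit)
  have hx_eq : x = y * z := by
    ext
    rw [Units.val_mul, hy, hz, hyz, hxb]
  rw [hx_eq]
  exact mul_mem (Subgroup.subset_closure ⟨v, by rw [hy, mul_comm]⟩)
    (Subgroup.subset_closure ⟨w, by rw [hz, mul_comm]⟩)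
end

section
/- Let R be a commutative ring, G an abelian group, and d : R × R → G a map satisfying the Dennis–Stein relations (D1), (D2) and (D3). Let t ∈ R, let u be a unit of R, and let l ≥ 1 be such that 1 + t^l·u is a unit of R. Then l • d(t^{l−1}·u, t) = d(u, t^l). (Since 1 + t^l·u = 1 + t·(t^{l−1}u), this says l·ρ_t(1 + t^l u) = ρ_{t^l}(1 + t^l u) = ⟨u, t^l⟩.) -/
/-- Iterating (D3): `(k + 1) • d(t^k·a, t) = d(a, t^(k+1))` for every `a` such that
`1 + t^(k+1)·a` is a unit. -/
theorem succ_nsmul_eq_of_symbol_mul {R G : Type*} [CommRing R] [AddCommGroup G] (d : R → R → G)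
    (hD3 : ∀ a b c : R, IsUnit (1 + a * b * c) → d a (b * c) = d (a * b) c + d (a * c) b)
    (t : R) (k : ℕ) (a : R) (ha : IsUnit (1 + t ^ (k + 1) * a)) :
    (k + 1) • d (t ^ k * a) t = d a (t ^ (k + 1)) := by
  induction k generalizing a with
  | zero => simp
  | succ k ih =>
    have h₁ : a * t ^ (k + 1) * t = t ^ (k + 1 + 1) * a := by ring
    have h₂ : t ^ (k + 1) * (a * t) = t ^ (k + 1 + 1) * a := by ring
    have h₃ : t ^ k * (a * t) = t ^ (k + 1) * a := by ring
    rw [pow_succ t (k + 1), hD3 a (t ^ (k + 1)) t (by rwa [h₁]), ← ih (a * t) (by rwa [h₂]), h₃,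
      succ_nsmul', mul_comm a]


/-- Let `R` be a commutative ring, `G` an abelian group and `d : R × R → G`
a map satisfying the Dennis–Stein relations (D1)–(D3).  Let `t ∈ R`, `u ∈ Rˣ` and `l ≥ 1`
with `1 + t^l·u` a unit.  Then `l • d(t^(l-1)·u, t) = d(u, t^l)`; i.e.
`l·ρ_t(1 + t^l·u) = ρ_{t^l}(1 + t^l·u) = ⟨u, t^l⟩`. -/
theorem dennis_stein_rho_power (R : Type*) [CommRing R] (G : Type*) [AddCommGroup G]
    (d : R → R → G)
    (hD1 : ∀ a b : R, IsUnit (1 + a * b) → d a b = - d (-b) (-a))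
    (hD2 : ∀ a b c : R, IsUnit (1 + a * b) → IsUnit (1 + a * c) →
      d a b + d a c = d a (b + c + a * b * c))
    (hD3 : ∀ a b c : R, IsUnit (1 + a * b * c) → d a (b * c) = d (a * b) c + d (a * c) b)
    (t : R) (u : Rˣ) (l : ℕ) (hl : 1 ≤ l) (hu : IsUnit (1 + t ^ l * (u : R))) :
    l • d (t ^ (l - 1) * (u : R)) t = d (u : R) (t ^ l) := by
  obtain ⟨k, rfl⟩ := Nat.exists_eq_add_of_le' hl
  exact succ_nsmul_eq_of_symbol_mul d hD3 t k u hu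
end

section
/- Let R be a Noetherian integrally closed (normal) domain and t ∈ R a prime element. Let u, v be units of R and n, m ∈ ℤ be such that u·tⁿ + v·t^m = 1 holds in the localisation R_t (where t is invertible). Then the unit c = (−1)^{n·m} · u^m · v^{−n} of R lies in 1 + tR, i.e. c − 1 ∈ tR. (This says that the tame symbol c(f,g) of units f, g of R_t with f + g = 1 lies in (1+tR)ˣ.) -/
/-- If `u * 0 ^ a + v * 0 ^ b = 0 ^ k` for units `u, v` of a nontrivial ring and one of the
exponents vanishes, then the tame symbol formed from `a - k` and `b - k` is trivial. -/
theorem tame_symbol_eq_one_of_zero_pow {A : Type*} [CommRing A] [Nontrivial A] (u v : Aˣ)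
    (a b k : ℕ) (h0 : a = 0 ∨ b = 0 ∨ k = 0)
    (h : (u : A) * 0 ^ a + (v : A) * 0 ^ b = 0 ^ k) :
    (-1 : Aˣ) ^ (((a : ℤ) - k) * ((b : ℤ) - k)) * u ^ ((b : ℤ) - k) * v ^ (-((a : ℤ) - k)) = 1 := by
  rcases eq_or_ne a 0 with ha | ha <;> rcases eq_or_ne b 0 with hb | hb <;>
    rcases eq_or_ne k 0 with hk | hk <;> simp [ha, hb, hk] at h h0
  · simp [ha, hb, hk]
  · have huv : u = -1 * v := by
      ext
      simpa using eq_neg_of_add_eq_zero_left h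
    subst ha hb
    have hpar : Even (((0 : ℤ) - k) * (0 - k) + (0 - k)) := by
      rw [← mul_add_one]
      exact Int.even_mul_succ_self _
    rw [huv, mul_zpow, Nat.cast_zero, ← mul_assoc, ← zpow_add, mul_assoc, ← zpow_add,
      hpar.neg_one_zpow]
    simp
  · simp [ha, hk, h]
  · simp [hb, hk, h]


/-- Let `R` be a Noetherian integrally closed (normal) domain and `t ∈ R` a
prime element; let `T` be the unit of `R_t` given by `t`.  Suppose `u, v ∈ Rˣ` and
`n, m ∈ ℤ` satisfy `u·tⁿ + v·t^m = 1` in `R_t`.  Then the tame symbol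
`c = (-1)^(n·m) · u^m · v^(-n) ∈ Rˣ` lies in `1 + tR`, i.e. `c - 1 ∈ tR`. -/
theorem tame_symbol_in_one_add_tR (R : Type*) [CommRing R] [IsDomain R]
    [IsNoetherianRing R] [IsIntegrallyClosed R]
    (t : R) (ht : Prime t)
    (T : (Localization.Away t)ˣ)
    (hT : (T : Localization.Away t) = algebraMap R (Localization.Away t) t)
    (u v : Rˣ) (n m : ℤ)
    (hsum : algebraMap R (Localization.Away t) (u : R) *
        ((T ^ n : (Localization.Away t)ˣ) : Localization.Away t) +
      algebraMap R (Localization.Away t) (v : R) *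
        ((T ^ m : (Localization.Away t)ˣ) : Localization.Away t) = 1) :
    (((((-1 : Rˣ) ^ (n * m) * u ^ m * v ^ (-n) : Rˣ) : R)) - 1) ∈ Ideal.span {t} := by
  let k : ℕ := max (-n).toNat (-m).toNat
  let a : ℕ := (n + k).toNat
  let b : ℕ := (m + k).toNat
  have ha : (a : ℤ) = n + k := by lia
  have hb : (b : ℤ) = m + k := by lia
  have h0 : a = 0 ∨ b = 0 ∨ k = 0 := by lia
  have hTa : T ^ n * T ^ k = T ^ a := by
    rw [← zpow_natCast, ← zpow_natCast, ha, zpow_add]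
  have hTb : T ^ m * T ^ k = T ^ b := by
    rw [← zpow_natCast, ← zpow_natCast, hb, zpow_add]
  have hR : (u : R) * t ^ a + (v : R) * t ^ b = t ^ k := by
    have hinj : Function.Injective (algebraMap R (Localization.Away t)) :=
      IsLocalization.injective _ (powers_le_nonZeroDivisors_of_noZeroDivisors ht.ne_zero)
    apply hinj
    simp only [map_add, map_mul, map_pow, ← hT, ← Units.val_pow_eq_pow_val, ← hTa, ← hTb]
    simp only [Units.val_mul, ← mul_assoc, ← add_mul, hsum, one_mul]
  let q := Ideal.Quotient.mk (Ideal.span {t})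
  have : Nontrivial (R ⧸ Ideal.span {t}) := Ideal.Quotient.nontrivial_iff.mpr
    ((Ideal.span_singleton_prime ht.ne_zero).mpr ht).ne_top
  have hqt : q t = 0 := Ideal.Quotient.eq_zero_iff_mem.mpr (Ideal.mem_span_singleton_self t)
  have hq := congrArg q hR
  simp only [map_add, map_mul, map_pow, hqt] at hq
  have key := tame_symbol_eq_one_of_zero_pow (Units.map (q : R →* R ⧸ Ideal.span {t}) u)
    (Units.map (q : R →* R ⧸ Ideal.span {t}) v) a b k h0 hq
  rw [show (a : ℤ) - k = n by lia, show (b : ℤ) - k = m by lia] at key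
  have hneg : Units.map (q : R →* R ⧸ Ideal.span {t}) (-1) = -1 := by
    ext
    simp
  rw [← hneg, ← map_zpow, ← map_zpow, ← map_zpow, ← map_mul, ← map_mul] at key
  rw [← Ideal.Quotient.eq_zero_iff_mem, map_sub, map_one, sub_eq_zero]
  exact congrArg Units.val key
end

section
/- Let R be a Noetherian integrally closed (normal) domain and t ∈ R a prime element. Let G be an abelian group, let s : Rˣ × Rˣ → G be bimultiplicative, satisfy the Steinberg relation, and satisfy s(a,−a) = 0 for all units a, and let d : R × R → G satisfy the Dennis–Stein relations (D1)–(D3) together with the compatibility: d(w, c) = s(−w, 1+wc) whenever w is a unit of R and 1 + w·c is a unit of R. Let u, v be units of R and n, m ∈ ℤ with u·tⁿ + v·t^m = 1 in the localisation R_t, and let a ∈ R satisfy 1 + t·a = (−1)^{n·m}·u^m·v^{−n} in R. Then d(a, t) = −s(u, v). (This says ρ_t(c(f,g)) = −{f·t^{−ν(f)}, g·t^{−ν(g)}} for units f, g of R_t with f + g = 1.) -/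
section BimultiplicativeMap

variable {H G : Type*} [CommGroup H] [AddCommGroup G] {s : H → H → G}

theorem bimul_one_left (hl : ∀ a b c, s (a * b) c = s a c + s b c) (c : H) : s 1 c = 0 := by
  simpa using hl 1 1 c

theorem bimul_one_right (hr : ∀ a b c, s a (b * c) = s a b + s a c) (c : H) : s c 1 = 0 := by
  simpa using hr c 1 1

theorem bimul_inv_left (hl : ∀ a b c, s (a * b) c = s a c + s b c) (a c : H) :
    s a⁻¹ c = - s a c := by
  have h := hl a⁻¹ a c
  rw [inv_mul_cancel, bimul_one_left hl] at h
  exact eq_neg_of_add_eq_zero_left h.symm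

theorem bimul_inv_right (hr : ∀ a b c, s a (b * c) = s a b + s a c) (a c : H) :
    s a c⁻¹ = - s a c := by
  have h := hr a c⁻¹ c
  rw [inv_mul_cancel, bimul_one_right hr] at h
  exact eq_neg_of_add_eq_zero_left h.symm

variable [HasDistribNeg H]

theorem bimul_antisymm (hl : ∀ a b c, s (a * b) c = s a c + s b c)
    (hr : ∀ a b c, s a (b * c) = s a b + s a c) (hs : ∀ a, s a (-a) = 0) (a b : H) :
    s a b = - s b a := by
  have h := hs (a * b)
  have h1 : s a (-(a * b)) = s a b := by rw [← neg_mul, hr, hs, zero_add]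
  have h2 : s b (-(a * b)) = s b a := by rw [← mul_neg, hr, hs, add_zero]
  rw [hl, h1, h2] at h
  exact eq_neg_of_add_eq_zero_left h

theorem bimul_neg_inv (hr : ∀ a b c, s a (b * c) = s a b + s a c) (hs : ∀ a, s a (-a) = 0)
    (a : H) : s a (-a⁻¹) = 0 := by
  have h1 : s a (-a⁻¹) = s a (-1) - s a a := by
    rw [← neg_one_mul, hr, bimul_inv_right hr, sub_eq_add_neg]
  have h2 : s a (-1) + s a a = 0 := by rw [← hr, neg_one_mul, hs]
  have h3 : s a (-1) + s a (-1) = 0 := by rw [← hr]; simpa using bimul_one_right hr a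
  rw [h1, eq_neg_of_add_eq_zero_right h2, sub_neg_eq_add, h3]

end BimultiplicativeMap

section DennisStein

variable {R G : Type*} [CommRing R] [AddCommGroup G] {d : R → R → G}

theorem dennisStein_zero_left
    (hD3 : ∀ a b c : R, IsUnit (1 + a * b * c) → d a (b * c) = d (a * b) c + d (a * c) b)
    (c : R) : d 0 c = 0 := by
  simpa using hD3 0 0 c (by simp)

theorem dennisStein_add_left
    (hD1 : ∀ a b : R, IsUnit (1 + a * b) → d a b = - d (-b) (-a))
    (hD2 : ∀ a b c : R, IsUnit (1 + a * b) → IsUnit (1 + a * c) →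
      d a b + d a c = d a (b + c + a * b * c))
    (a b t : R) (ha : IsUnit (1 + a * t)) (hb : IsUnit (1 + b * t)) :
    d a t + d b t = d (a + b + a * b * t) t := by
  have hab : IsUnit (1 + (a + b + a * b * t) * t) := by
    convert ha.mul hb using 1
    ring
  have h := hD2 (-t) (-a) (-b) (by convert ha using 1; ring) (by convert hb using 1; ring)
  have e : -a + -b + -t * -a * -b = -(a + b + a * b * t) := by ring
  rw [e] at h
  rw [hD1 a t ha, hD1 b t hb, hD1 _ t hab, ← h]
  abel

theorem dennisStein_pow_right
    (hD3 : ∀ a b c : R, IsUnit (1 + a * b * c) → d a (b * c) = d (a * b) c + d (a * c) b)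
    (t : R) (k : ℕ) (b : R) (hb : IsUnit (1 + b * t ^ (k + 1))) :
    d b (t ^ (k + 1)) = (k + 1) • d (b * t ^ k) t := by
  induction k generalizing b with
  | zero => simp
  | succ k ih =>
    have e : b * t * t ^ (k + 1) = b * t ^ (k + 1 + 1) := by ring
    have e' : b * t * t ^ k = b * t ^ (k + 1) := by ring
    rw [pow_succ' t (k + 1), hD3 b t _ (by rwa [e]), ih (b * t) (by rwa [e]), e', ← succ_nsmul]

variable [IsDomain R]

theorem dennisStein_nsmul_left
    (hD1 : ∀ a b : R, IsUnit (1 + a * b) → d a b = - d (-b) (-a))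
    (hD2 : ∀ a b c : R, IsUnit (1 + a * b) → IsUnit (1 + a * c) →
      d a b + d a c = d a (b + c + a * b * c))
    (hD3 : ∀ a b c : R, IsUnit (1 + a * b * c) → d a (b * c) = d (a * b) c + d (a * c) b)
    {t : R} (ht : t ≠ 0) {b : R} (hb : IsUnit (1 + b * t)) (k : ℕ) (a : R)
    (ha : 1 + t * a = (1 + b * t) ^ k) :
    d a t = k • d b t := by
  induction k generalizing a with
  | zero =>
    have : a = 0 := by simpa [ht] using ha
    rw [this, dennisStein_zero_left hD3, zero_smul]
  | succ k ih =>
    obtain ⟨c, hc⟩ : t ∣ (1 + b * t) ^ k - 1 := by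
      have h := sub_dvd_pow_sub_pow (1 + b * t) 1 k
      rw [one_pow, add_sub_cancel_left] at h
      exact (Dvd.intro_left b rfl).trans h
    have hc' : 1 + t * c = (1 + b * t) ^ k := by rw [← hc]; ring
    have e : a = c + b + c * b * t := by
      apply mul_left_cancel₀ ht
      linear_combination ha - (1 + b * t) * hc'
    rw [succ_nsmul, ← ih c hc', e]
    refine (dennisStein_add_left hD1 hD2 c b t ?_ hb).symm
    rw [mul_comm c, hc']
    exact hb.pow k

theorem dennisStein_pow
    (hD1 : ∀ a b : R, IsUnit (1 + a * b) → d a b = - d (-b) (-a))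
    (hD2 : ∀ a b c : R, IsUnit (1 + a * b) → IsUnit (1 + a * c) →
      d a b + d a c = d a (b + c + a * b * c))
    (hD3 : ∀ a b c : R, IsUnit (1 + a * b * c) → d a (b * c) = d (a * b) c + d (a * c) b)
    {t : R} (ht : t ≠ 0) {k : ℕ} (hk : 0 < k) {b : R} (hb : IsUnit (1 + b * t ^ k)) (a : R)
    (ha : 1 + t * a = (1 + b * t ^ k) ^ k) :
    d a t = d b (t ^ k) := by
  obtain ⟨k, rfl⟩ := Nat.exists_eq_succ_of_ne_zero hk.ne'
  have e : b * t ^ (k + 1) = b * t ^ k * t := by ring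
  rw [Nat.succ_eq_add_one] at *
  rw [dennisStein_pow_right hD3 t k b hb]
  rw [e] at hb ha
  exact dennisStein_nsmul_left hD1 hD2 hD3 ht hb _ a ha

end DennisStein

/-- Clearing denominators in an equation `x tⁿ + y tᵐ = 1` of the localisation. -/
theorem Localization.Away.clear_zpow {R : Type*} [CommRing R] [IsDomain R] {t : R} (ht : t ≠ 0)
    {T : (Localization.Away t)ˣ}
    (hT : (T : Localization.Away t) = algebraMap R (Localization.Away t) t)
    {x y : R} {n m : ℤ}
    (h : algebraMap R (Localization.Away t) x *
        ((T ^ n : (Localization.Away t)ˣ) : Localization.Away t) +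
      algebraMap R (Localization.Away t) y *
        ((T ^ m : (Localization.Away t)ˣ) : Localization.Away t) = 1)
    (N M K : ℕ) (hN : (N : ℤ) = n + K) (hM : (M : ℤ) = m + K) :
    x * t ^ N + y * t ^ M = t ^ K := by
  apply IsLocalization.injective (Localization.Away t)
    (powers_le_nonZeroDivisors_of_noZeroDivisors ht)
  have eN : T ^ N = T ^ n * T ^ K := by rw [← zpow_natCast, hN, zpow_add, zpow_natCast]
  have eM : T ^ M = T ^ m * T ^ K := by rw [← zpow_natCast, hM, zpow_add, zpow_natCast]
  have eN' := congrArg Units.val eN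
  have eM' := congrArg Units.val eM
  simp only [Units.val_pow_eq_pow_val, Units.val_mul, hT] at eN' eM'
  simp only [map_add, map_mul, map_pow, eN', eM']
  linear_combination (algebraMap R (Localization.Away t) t) ^ K * h

/-- Let `R` be a Noetherian integrally closed (normal) domain, `t ∈ R` a
prime element, and `T` the unit of `R_t` given by `t`.  Let `G` be an abelian group,
`s : Rˣ × Rˣ → G` a bimultiplicative map satisfying the Steinberg relation and
skew-symmetry, and `d : R × R → G` a map satisfying the Dennis–Stein relations (D1)–(D3)
which is compatible with `s`: `d(w,c) = s(-w, 1+w·c)` whenever `w` and `1 + w·c` are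
units.  Suppose `u, v ∈ Rˣ` and `n, m ∈ ℤ` satisfy `u·tⁿ + v·t^m = 1` in `R_t`, and
`a ∈ R` satisfies `1 + t·a = (-1)^(n·m)·u^m·v^(-n)` in `R`.  Then `d(a,t) = -s(u,v)`;
i.e. `ρ_t(c(f,g)) = -{f·t^(-ν f), g·t^(-ν g)}` for units `f, g` of `R_t` with
`f + g = 1`. -/
theorem rho_of_tame_symbol (R : Type*) [CommRing R] [IsDomain R]
    [IsNoetherianRing R] [IsIntegrallyClosed R]
    (t : R) (ht : Prime t)
    (T : (Localization.Away t)ˣ)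
    (hT : (T : Localization.Away t) = algebraMap R (Localization.Away t) t)
    (G : Type*) [AddCommGroup G] (s : Rˣ → Rˣ → G)
    (hmul_left : ∀ a b c : Rˣ, s (a * b) c = s a c + s b c)
    (hmul_right : ∀ a b c : Rˣ, s a (b * c) = s a b + s a c)
    (hsteinberg : ∀ a b : Rˣ, (a : R) + (b : R) = 1 → s a b = 0)
    (hskew : ∀ a : Rˣ, s a (-a) = 0)
    (d : R → R → G)
    (hD1 : ∀ a b : R, IsUnit (1 + a * b) → d a b = - d (-b) (-a))
    (hD2 : ∀ a b c : R, IsUnit (1 + a * b) → IsUnit (1 + a * c) →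
      d a b + d a c = d a (b + c + a * b * c))
    (hD3 : ∀ a b c : R, IsUnit (1 + a * b * c) → d a (b * c) = d (a * b) c + d (a * c) b)
    (hcompat : ∀ (w : Rˣ) (c : R) (h : IsUnit (1 + (w : R) * c)),
      d (w : R) c = s (-w) h.unit)
    (u v : Rˣ) (n m : ℤ)
    (hsum : algebraMap R (Localization.Away t) (u : R) *
        ((T ^ n : (Localization.Away t)ˣ) : Localization.Away t) +
      algebraMap R (Localization.Away t) (v : R) *
        ((T ^ m : (Localization.Away t)ˣ) : Localization.Away t) = 1)
    (a : R)
    (ha : 1 + t * a = ((((-1 : Rˣ) ^ (n * m) * u ^ m * v ^ (-n) : Rˣ) : R))) :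
    d a t = - s u v := by
  have ht0 := ht.ne_zero
  have clear := Localization.Away.clear_zpow ht0 hT hsum
  have not_dvd (w : Rˣ) : ¬ t ∣ (w : R) := fun h => ht.not_isUnit (isUnit_of_dvd_unit h w.isUnit)
  have dvd_pow' {k : ℕ} (hk : 0 < k) : t ∣ t ^ k := dvd_pow_self t hk.ne'
  have symb (w x : Rˣ) (c : R) (h : (x : R) = 1 + w * c) : d w c = s (-w) x := by
    have hu : IsUnit (1 + (w : R) * c) := h ▸ x.isUnit
    rw [hcompat w c hu]
    congr 1
    exact Units.ext h.symm
  have anti := bimul_antisymm hmul_left hmul_right hskew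
  have hcases : (n = 0 ∧ m = 0) ∨ (n = 0 ∧ 0 < m) ∨ (m = 0 ∧ 0 < n) ∨ (n = m ∧ n < 0) ∨
      (n < 0 ∧ n < m) ∨ (m < 0 ∧ m < n) ∨ (0 < n ∧ 0 < m) := by omega
  rcases hcases with ⟨rfl, rfl⟩ | ⟨rfl, hm⟩ | ⟨rfl, hn⟩ | ⟨rfl, hn⟩ | ⟨hn, hnm⟩ | ⟨hm, hmn⟩ |
    ⟨hn, hm⟩
  · have h := clear 0 0 0 (by simp) (by simp)
    simp only [pow_zero, mul_one] at h
    have ha0 : a = 0 := by simpa [ht0] using ha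
    rw [ha0, dennisStein_zero_left hD3, hsteinberg u v h, neg_zero]
  · obtain ⟨k, rfl⟩ := Int.eq_ofNat_of_zero_le hm.le
    have h := clear 0 k 0 (by simp) (by simp)
    simp only [pow_zero, mul_one] at h
    have hu : (u : R) = 1 + ((-v : Rˣ) : R) * t ^ k := by
      push_cast
      linear_combination h
    rw [dennisStein_pow hD1 hD2 hD3 ht0 (by omega) (hu ▸ u.isUnit) a
      (by rw [ha, ← hu]; simp), symb _ _ _ hu, neg_neg, anti]
  · obtain ⟨k, rfl⟩ := Int.eq_ofNat_of_zero_le hn.le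
    have h := clear k 0 0 (by simp) (by simp)
    simp only [pow_zero, mul_one] at h
    have hv : (v : R) = 1 + ((-u : Rˣ) : R) * t ^ k := by
      push_cast
      linear_combination h
    have hak : (1 + t * a) * (v : R) ^ k = 1 := by
      rw [ha, ← Units.val_pow_eq_pow_val, ← Units.val_mul]
      simp
    obtain ⟨c, hc⟩ : t ∣ (v : R) ^ k - 1 := by
      have h' := sub_dvd_pow_sub_pow (v : R) 1 k
      rw [one_pow, hv, add_sub_cancel_left, ← hv] at h'
      exact ((dvd_pow' (by omega)).mul_left _).trans h'
    have hc' : 1 + t * c = (v : R) ^ k := by rw [← hc]; ring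
    have hdc : d c t = s u v := by
      rw [dennisStein_pow hD1 hD2 hD3 ht0 (by omega) (hv ▸ v.isUnit) c
        (by rw [hc', ← hv]), symb _ _ _ hv, neg_neg]
    have hsum0 : d a t + d c t = 0 := by
      rw [dennisStein_add_left hD1 hD2 a c t (by rw [mul_comm a, ha]; exact Units.isUnit _)
        (by rw [mul_comm c, hc']; exact v.isUnit.pow k)]
      have : a + c + a * c * t = 0 := by
        apply mul_left_cancel₀ ht0
        linear_combination hak + (1 + t * a) * hc'
      rw [this, dennisStein_zero_left hD3]
    rw [← hdc]
    exact eq_neg_of_add_eq_zero_left hsum0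
  · obtain ⟨k, hk⟩ := Int.eq_ofNat_of_zero_le (neg_nonneg.mpr hn.le)
    obtain rfl : n = -(k : ℤ) := by omega
    have h := clear 0 0 k (by simp) (by simp)
    simp only [pow_zero, mul_one] at h
    have hw : ((-(v * u⁻¹) : Rˣ) : R) = 1 + ((-u⁻¹ : Rˣ) : R) * t ^ k := by
      rw [← h]
      push_cast
      linear_combination u.mul_inv
    have hpow : (-1 : Rˣ) ^ (-(k : ℤ) * -(k : ℤ)) * u ^ (-(k : ℤ)) * v ^ (-(-(k : ℤ))) =
        (-(v * u⁻¹)) ^ k := by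
      have e : (-1 : Rˣ) ^ (-(k : ℤ) * -(k : ℤ)) = (-1) ^ k := by
        rw [neg_mul_neg, zpow_mul, zpow_natCast, zpow_natCast]
        rcases Nat.even_or_odd k with hk | hk
        · simp [hk.neg_one_pow]
        · simp [hk.neg_one_pow]
      rw [e, neg_pow (v * u⁻¹), mul_pow, neg_neg, zpow_neg, zpow_natCast, zpow_natCast, inv_pow,
        mul_assoc, mul_comm (v ^ k)]
    rw [dennisStein_pow hD1 hD2 hD3 ht0 (by omega) (hw ▸ Units.isUnit _) a
      (by rw [ha, ← hw, hpow, Units.val_pow_eq_pow_val]), symb _ _ _ hw, neg_neg,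
      bimul_inv_left hmul_left, ← mul_neg, hmul_right, bimul_neg_inv hmul_right hskew, add_zero]
  · have h := clear 0 (m - n).toNat (-n).toNat (by omega) (by omega)
    refine absurd ?_ (not_dvd u)
    rw [show (u : R) = t ^ (-n).toNat - v * t ^ (m - n).toNat by linear_combination h]
    exact dvd_sub (dvd_pow' (by omega)) ((dvd_pow' (by omega)).mul_left _)
  · have h := clear (n - m).toNat 0 (-m).toNat (by omega) (by omega)
    refine absurd ?_ (not_dvd v)
    rw [show (v : R) = t ^ (-m).toNat - u * t ^ (n - m).toNat by linear_combination h]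
    exact dvd_sub (dvd_pow' (by omega)) ((dvd_pow' (by omega)).mul_left _)
  · have h := clear n.toNat m.toNat 0 (by omega) (by omega)
    refine absurd ?_ (not_dvd 1)
    rw [Units.val_one, ← pow_zero t, ← h]
    exact dvd_add ((dvd_pow' (by omega)).mul_left _) ((dvd_pow' (by omega)).mul_left _)
end

section
/- Let A be a Noetherian integrally closed (normal) local domain and let t₁,…,t_k ∈ A be pairwise non-associated prime elements. Then every unit w of the localisation A_{t₁⋯t_k} (A with the powers of t₁⋯t_k inverted) can be written as w = u·t₁^{α₁}⋯t_k^{α_k} for some unit u of A and integers α₁,…,α_k ∈ ℤ. -/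
/-- A divisor of a power of a product of primes is a unit times a product of powers of these
primes. -/
theorem exists_unit_mul_prod_pow_of_dvd {A ι : Type*} [CommRing A] [IsDomain A] [Fintype ι]
    {t : ι → A} (ht : ∀ i, Prime (t i)) {x : A} {n : ℕ} (hx : x ∣ (∏ i, t i) ^ n) :
    ∃ (u : Aˣ) (m : ι → ℕ), x = u * ∏ i, t i ^ m i := by
  classical
  obtain ⟨y, hy⟩ := hx
  have h : x * y = 1 * ∏ j ∈ (Finset.univ : Finset (ι × Fin n)), t j.1 := by
    simp [← hy, Fintype.prod_prod_type, Finset.prod_pow]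
  obtain ⟨s, -, b, c, -, -, hbc, hb, -⟩ := mul_eq_mul_prime_prod (fun j _ => ht j.1) h
  refine ⟨Units.mkOfMulEqOne b c hbc.symm, fun i => (s.filter fun j => j.1 = i).card, ?_⟩
  rw [hb, ← Finset.prod_fiberwise s Prod.fst]
  congr 1
  refine Finset.prod_congr rfl fun i _ => ?_
  exact Finset.prod_eq_pow_card fun j hj => by rw [(Finset.mem_filter.mp hj).2]


/-- Let `A` be a Noetherian integrally closed (normal) local domain and
`t₁, …, t_k ∈ A` pairwise non-associated prime elements; let `Tᵢ` be the unit of the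
localisation `A_{t₁⋯t_k}` given by `tᵢ`.  Then every unit `w` of `A_{t₁⋯t_k}` can be
written as `w = u · t₁^{α₁} ⋯ t_k^{α_k}` with `u ∈ Aˣ` and `α₁, …, α_k ∈ ℤ`. -/
theorem units_of_localisation_away_prod (A : Type*) [CommRing A] [IsDomain A]
    [IsNoetherianRing A] [IsIntegrallyClosed A] [IsLocalRing A]
    (k : ℕ) (t : Fin k → A) (ht : ∀ i, Prime (t i))
    (hassoc : ∀ i j, i ≠ j → ¬ Associated (t i) (t j))
    (T : Fin k → (Localization.Away (∏ i, t i))ˣ)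
    (hT : ∀ i, ((T i : (Localization.Away (∏ i, t i))ˣ) : Localization.Away (∏ i, t i)) =
      algebraMap A (Localization.Away (∏ i, t i)) (t i))
    (w : (Localization.Away (∏ i, t i))ˣ) :
    ∃ (u : Aˣ) (α : Fin k → ℤ),
      (w : Localization.Away (∏ i, t i)) =
        algebraMap A (Localization.Away (∏ i, t i)) (u : A) *
          ∏ i, ((T i ^ α i : (Localization.Away (∏ i, t i))ˣ) :
            Localization.Away (∏ i, t i)) := by
  revert T w
  generalize hP : ∏ i, t i = P
  intro T hT w
  have hP0 : P ≠ 0 := hP ▸ Finset.prod_ne_zero_iff.mpr fun i _ => (ht i).ne_zero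
  have hinj : Function.Injective (algebraMap A (Localization.Away P)) :=
    IsLocalization.injective _ (powers_le_nonZeroDivisors_of_noZeroDivisors hP0)
  obtain ⟨n, x, hx⟩ := IsLocalization.Away.surj P (w : Localization.Away P)
  obtain ⟨m, y, hy⟩ := IsLocalization.Away.surj P ((w⁻¹ : (Localization.Away P)ˣ) :
    Localization.Away P)
  have hxy : P ^ (n + m) = x * y := by
    apply hinj
    rw [map_mul, ← hx, ← hy, map_pow, pow_add, mul_mul_mul_comm, Units.mul_inv, one_mul]
  obtain ⟨u, e, rfl⟩ := exists_unit_mul_prod_pow_of_dvd ht (hP ▸ Dvd.intro y hxy.symm)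
  have hTP : algebraMap A (Localization.Away P) P =
      ((∏ i, T i : (Localization.Away P)ˣ) : Localization.Away P) := by
    simp only [Units.coe_prod, hT, ← map_prod, hP]
  refine ⟨u, fun i => (e i : ℤ) - n, ?_⟩
  have hprod : ∏ i, T i ^ ((e i : ℤ) - n) = (∏ i, T i ^ e i) * ((∏ i, T i) ^ n)⁻¹ := by
    simp only [zpow_sub, zpow_natCast, Finset.prod_mul_distrib, Finset.prod_inv_distrib,
      Finset.prod_pow]
  rw [← Units.coe_prod, hprod, Units.val_mul, ← mul_assoc, Units.eq_mul_inv_iff_mul_eq,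
    Units.val_pow_eq_pow_val, ← hTP, hx]
  simp only [map_mul, map_prod, map_pow, Units.coe_prod, Units.val_pow_eq_pow_val, hT]
end
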